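/- Fix q ∈ (0,1), and let γ_q ∈ [0,1] be the constant such that L^q_n/n → γ_q as n → ∞, where L^q_n is the expected length of the longest common subsequence of two independent binary strings of length n drawn from the symmetric first-order Markov distribution with parameter q. Then for every p with 0 < p < 1 - γ_q, there exist a constant c > 0 and an integer N such that for all n ≥ N there is a set C of binary strings of length n with |C| ≥ 2^{c·n} and with the property that any two distinct strings of C have longest common subsequence of length strictly less than (1-p)·n. (Hence the zero-error capacity of the adversarial deletion channel that deletes up to p·n of n transmitted bits is positive whenever p < 1 - γ_q.) -/

import Mathlib

/-- The length of the longest common subsequence of two lists. -/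
noncomputable def lcsLen (x y : List Bool) : ℕ :=
  sSup {m : ℕ | ∃ z : List Bool, z.Sublist x ∧ z.Sublist y ∧ z.length = m}

/-- `delta l` is the number of adjacent positions of the list `l` holding
different values. -/
def delta : List Bool → ℕ
  | [] => 0
  | [_] => 0
  | a :: b :: t => (if a ≠ b then 1 else 0) + delta (b :: t)

/-- The symmetric first-order Markov distribution with parameter q assigns a string
s of length n the probability (1/2)·q^{n-1-Δ(s)}·(1-q)^{Δ(s)}. -/
noncomputable def markovP (q : ℝ) {n : ℕ} (s : Fin n → Bool) : ℝ :=
  (1 / 2 : ℝ) * q ^ (n - 1 - delta (List.ofFn s)) * (1 - q) ^ (delta (List.ofFn s))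

/-- `expLCSMarkov q n` is the expected LCS length of two independent strings of
length n, each drawn from the symmetric first-order Markov distribution with
parameter q. -/
noncomputable def expLCSMarkov (q : ℝ) (n : ℕ) : ℝ :=
  ∑ x : Fin n → Bool, ∑ y : Fin n → Bool,
    markovP q x * markovP q y * (lcsLen (List.ofFn x) (List.ofFn y) : ℝ)

/-- Expectation of `f` over the next `n` letters of the chain, started in state `a`. -/
noncomputable def EE (q : ℝ) : ℕ → Bool → (List Bool → ℝ) → ℝ
  | 0, _, f => f []
  | n + 1, a, f => q * EE q n a (fun l => f (a :: l)) + (1 - q) * EE q n (!a) (fun l => f ((!a) :: l))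

/-- Expectation with a uniform initial state. -/
noncomputable def Et (q : ℝ) (n : ℕ) (f : List Bool → ℝ) : ℝ :=
  (EE q n false f + EE q n true f) / 2

/-- Transition weight of a list after state `a`. -/
noncomputable def wt (q : ℝ) : Bool → List Bool → ℝ
  | _, [] => 1
  | a, b :: t => (if a = b then q else 1 - q) * wt q b t

/-- Changing one letter changes the value by at most one. -/
def Lip (f : List Bool → ℝ) : Prop :=
  ∀ u a b v, f (u ++ a :: v) ≤ f (u ++ b :: v) + 1

lemma Lip.cons {f : List Bool → ℝ} (h : Lip f) (a : Bool) : Lip (fun l => f (a :: l)) := by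
  intro u b c v
  simpa using h (a :: u) b c v

lemma EE_mono {q : ℝ} (h0 : 0 ≤ q) (h1 : q ≤ 1) (n : ℕ) : ∀ (a : Bool) (f g : List Bool → ℝ),
    (∀ l, f l ≤ g l) → EE q n a f ≤ EE q n a g := by
  induction n with
  | zero => intro a f g h; exact h []
  | succ n ih =>
    intro a f g h
    simp only [EE]
    have h2 := ih a _ _ (fun l => h (a :: l))
    have h3 := ih (!a) _ _ (fun l => h ((!a) :: l))
    have : 0 ≤ 1 - q := by linarith
    gcongr

lemma EE_add {q : ℝ} (n : ℕ) : ∀ (a : Bool) (f : List Bool → ℝ) (c : ℝ),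
    EE q n a (fun l => f l + c) = EE q n a f + c := by
  induction n with
  | zero => intro a f c; rfl
  | succ n ih =>
    intro a f c
    simp only [EE]
    rw [ih a (fun l => f (a :: l)) c, ih (!a) (fun l => f ((!a) :: l)) c]
    ring

lemma EE_mul {q : ℝ} (n : ℕ) : ∀ (a : Bool) (f : List Bool → ℝ) (c : ℝ),
    EE q n a (fun l => c * f l) = c * EE q n a f := by
  induction n with
  | zero => intro a f c; rfl
  | succ n ih =>
    intro a f c
    simp only [EE]
    rw [ih a (fun l => f (a :: l)) c, ih (!a) (fun l => f ((!a) :: l)) c]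
    ring

lemma Et_mono {q : ℝ} (h0 : 0 ≤ q) (h1 : q ≤ 1) (n : ℕ) (f g : List Bool → ℝ)
    (h : ∀ l, f l ≤ g l) : Et q n f ≤ Et q n g := by
  have := EE_mono h0 h1 n false f g h
  have := EE_mono h0 h1 n true f g h
  unfold Et
  linarith

lemma Et_add {q : ℝ} (n : ℕ) (f : List Bool → ℝ) (c : ℝ) :
    Et q n (fun l => f l + c) = Et q n f + c := by
  unfold Et
  rw [EE_add, EE_add]; ring

lemma Et_mul {q : ℝ} (n : ℕ) (f : List Bool → ℝ) (c : ℝ) :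
    Et q n (fun l => c * f l) = c * Et q n f := by
  unfold Et
  rw [EE_mul, EE_mul]; ring

lemma step_diff {q r K : ℝ} (h0 : 0 ≤ q) (h1 : q ≤ 1) (hK : 1 + r * K = K) (n : ℕ)
    (hD : ∀ f, Lip f → |EE q n false f - EE q n true f| ≤ r * K)
    (f : List Bool → ℝ) (hf : Lip f) :
    |EE q n false (fun l => f (false :: l)) - EE q n true (fun l => f (true :: l))| ≤ K := by
  have a1 := EE_mono h0 h1 n false (fun l => f (false :: l)) (fun l => f (true :: l) + 1)
    (fun l => hf [] false true l)
  have a2 := EE_mono h0 h1 n false (fun l => f (true :: l)) (fun l => f (false :: l) + 1)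
    (fun l => hf [] true false l)
  rw [EE_add n false (fun l => f (true :: l))] at a1
  rw [EE_add n false (fun l => f (false :: l))] at a2
  have a3 := abs_le.1 (hD _ (hf.cons true))
  rw [abs_le]
  constructor <;> linarith [a3.1, a3.2]

lemma EE_diff {q r K : ℝ} (h0 : 0 ≤ q) (h1 : q ≤ 1) (hr : r = |2 * q - 1|) (hK : 1 + r * K = K)
    (hK0 : 0 ≤ K) (n : ℕ) : ∀ f, Lip f → |EE q n false f - EE q n true f| ≤ r * K := by
  have hr0 : 0 ≤ r := hr ▸ abs_nonneg _
  induction n with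
  | zero => intro f _; simp only [EE, sub_self, abs_zero]; positivity
  | succ n ih =>
    intro f hf
    have h := step_diff h0 h1 hK n ih f hf
    have e : EE q (n+1) false f - EE q (n+1) true f = (2 * q - 1) *
      (EE q n false (fun l => f (false :: l)) - EE q n true (fun l => f (true :: l))) := by
      simp only [EE, Bool.not_false, Bool.not_true]; ring
    rw [e, abs_mul, ← hr]
    gcongr

lemma two_point {w t K x y : ℝ} (h0 : 0 ≤ w) (h1 : w ≤ 1) (ht : 0 ≤ t) (htK : t * K ≤ 1)
    (hxy : |x - y| ≤ K) :
    w * Real.exp (t * x) + (1 - w) * Real.exp (t * y) ≤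
      Real.exp (t * (w * x + (1 - w) * y) + K ^ 2 * t ^ 2) := by
  have key : ∀ d : ℝ, |d| ≤ t * K → Real.exp d ≤ 1 + d + K ^ 2 * t ^ 2 := by
    intro d hd
    have h := Real.abs_exp_sub_one_sub_id_le (x := d) (hd.trans htK)
    have h3 := (abs_le.1 h).2
    have : d ^ 2 ≤ (t * K) ^ 2 := by
      rw [← sq_abs d]; gcongr
    nlinarith
  have w1 : 0 ≤ 1 - w := by linarith
  set m := w * x + (1 - w) * y with hm
  have b1 : |t * (x - m)| ≤ t * K := by
    have : x - m = (1 - w) * (x - y) := by rw [hm]; ring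
    rw [this, abs_mul, abs_mul, abs_of_nonneg ht, abs_of_nonneg w1]
    gcongr
    nlinarith [abs_nonneg (x - y)]
  have b2 : |t * (y - m)| ≤ t * K := by
    have : y - m = w * -(x - y) := by rw [hm]; ring
    rw [this, abs_mul, abs_mul, abs_of_nonneg ht, abs_of_nonneg h0, abs_neg]
    gcongr
    nlinarith [abs_nonneg (x - y)]
  have k1 := key _ b1
  have k2 := key _ b2
  have e1 : Real.exp (t * x) = Real.exp (t * m) * Real.exp (t * (x - m)) := by
    rw [← Real.exp_add]; ring_nf
  have e2 : Real.exp (t * y) = Real.exp (t * m) * Real.exp (t * (y - m)) := by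
    rw [← Real.exp_add]; ring_nf
  have hs : w * Real.exp (t * (x - m)) + (1 - w) * Real.exp (t * (y - m)) ≤ 1 + K ^ 2 * t ^ 2 := by
    calc _ ≤ w * (1 + t * (x - m) + K ^ 2 * t ^ 2) + (1 - w) * (1 + t * (y - m) + K ^ 2 * t ^ 2) := by
          gcongr
      _ = _ := by rw [hm]; ring
  rw [e1, e2, Real.exp_add]
  calc _ = Real.exp (t * m) * (w * Real.exp (t * (x - m)) + (1 - w) * Real.exp (t * (y - m))) := by ring
    _ ≤ _ := by
      gcongr
      exact hs.trans (by linarith [Real.add_one_le_exp (K ^ 2 * t ^ 2)])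

lemma EE_mgf {q r K t : ℝ} (h0 : 0 ≤ q) (h1 : q ≤ 1) (hr : r = |2 * q - 1|) (hK : 1 + r * K = K)
    (hK0 : 0 ≤ K) (ht : 0 ≤ t) (htK : t * K ≤ 1) (n : ℕ) : ∀ a f, Lip f →
    EE q n a (fun l => Real.exp (t * f l)) ≤ Real.exp (t * EE q n a f + n * (K ^ 2 * t ^ 2)) := by
  induction n with
  | zero => intro a f _; simp [EE]
  | succ n ih =>
    intro a f hf
    have hd : |EE q n a (fun l => f (a :: l)) - EE q n (!a) (fun l => f ((!a) :: l))| ≤ K := by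
      have h := step_diff h0 h1 hK n (EE_diff h0 h1 hr hK hK0 n) f hf
      cases a
      · exact h
      · rw [abs_sub_comm]; exact h
    have i1 := ih a _ (hf.cons a)
    have i2 := ih (!a) _ (hf.cons (!a))
    have w1 : 0 ≤ 1 - q := by linarith
    have tp := two_point h0 h1 ht htK hd
    simp only [EE]
    calc _ ≤ q * Real.exp (t * EE q n a (fun l => f (a :: l)) + n * (K ^ 2 * t ^ 2)) + (1 - q) *
          Real.exp (t * EE q n (!a) (fun l => f ((!a) :: l)) + n * (K ^ 2 * t ^ 2)) := by gcongr
      _ = (q * Real.exp (t * EE q n a (fun l => f (a :: l))) + (1 - q) *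
          Real.exp (t * EE q n (!a) (fun l => f ((!a) :: l)))) * Real.exp (n * (K ^ 2 * t ^ 2)) := by
          rw [Real.exp_add, Real.exp_add]; ring
      _ ≤ _ := mul_le_mul_of_nonneg_right tp (Real.exp_nonneg _)
      _ = _ := by rw [← Real.exp_add]; push_cast; ring_nf

lemma Et_mgf {q r K t : ℝ} (h0 : 0 ≤ q) (h1 : q ≤ 1) (hr : r = |2 * q - 1|) (hK : 1 + r * K = K)
    (hK0 : 0 ≤ K) (ht : 0 ≤ t) (htK : t * K ≤ 1) (n : ℕ) (f : List Bool → ℝ) (hf : Lip f) :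
    Et q n (fun l => Real.exp (t * f l)) ≤ Real.exp (t * Et q n f + (n + 1) * (K ^ 2 * t ^ 2)) := by
  have i1 := EE_mgf h0 h1 hr hK hK0 ht htK n false f hf
  have i2 := EE_mgf h0 h1 hr hK hK0 ht htK n true f hf
  have hd := EE_diff h0 h1 hr hK hK0 n f hf
  have tp := two_point (w := 1/2) (by norm_num) (by norm_num) ht htK
    (show |EE q n false f - EE q n true f| ≤ K by linarith)
  unfold Et
  rw [Real.exp_add] at i1 i2
  calc _ ≤ (1/2 * Real.exp (t * EE q n false f) + (1 - 1/2) * Real.exp (t * EE q n true f)) *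
        Real.exp (n * (K ^ 2 * t ^ 2)) := by linarith
    _ ≤ _ := mul_le_mul_of_nonneg_right tp (Real.exp_nonneg _)
    _ = _ := by rw [← Real.exp_add]; ring_nf

lemma delta_le (l : List Bool) : ∀ a, delta (a :: l) ≤ l.length := by
  induction l with
  | nil => intro a; simp [delta]
  | cons b t ih =>
    intro a
    have := ih b
    simp only [delta, List.length_cons]
    split_ifs <;> omega

lemma wt_eq (q : ℝ) (l : List Bool) : ∀ a,
    wt q a l = q ^ (l.length - delta (a :: l)) * (1 - q) ^ (delta (a :: l)) := by
  induction l with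
  | nil => intro a; simp [delta, wt]
  | cons b t ih =>
    intro a
    have h := delta_le t b
    simp only [delta, wt, List.length_cons, ih b]
    by_cases hab : a = b
    · have : t.length + 1 - (0 + delta (b :: t)) = (t.length - delta (b :: t)) + 1 := by omega
      simp only [hab, if_true, ne_eq, not_true_eq_false, if_false, this]
      rw [pow_succ, zero_add]; ring
    · have : t.length + 1 - (1 + delta (b :: t)) = (t.length - delta (b :: t)) := by omega
      simp only [hab, if_true, ne_eq, not_false_eq_true, if_false, this]
      rw [pow_add]; ring

lemma markovP_eq (q : ℝ) {n : ℕ} (hn : 0 < n) (x : Fin n → Bool) :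
    markovP q x = (wt q false (List.ofFn x) + wt q true (List.ofFn x)) / 2 := by
  obtain ⟨n, rfl⟩ : ∃ k, n = k + 1 := ⟨n - 1, by omega⟩
  unfold markovP
  rw [List.ofFn_succ]
  have := wt_eq q (List.ofFn fun i : Fin n => x i.succ) (x 0)
  rw [List.length_ofFn] at this
  rw [Nat.add_sub_cancel, mul_assoc, ← this]
  simp only [wt]
  cases x 0 <;> simp <;> ring

lemma EE_eq_sum (q : ℝ) (n : ℕ) : ∀ a f,
    EE q n a f = ∑ x : Fin n → Bool, wt q a (List.ofFn x) * f (List.ofFn x) := by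
  induction n with
  | zero => intro a f; simp [EE, wt]
  | succ n ih =>
    intro a f
    rw [← (Fin.consEquiv (fun _ : Fin (n+1) => Bool)).sum_comp, Fintype.sum_prod_type]
    simp only [EE, ih, Fin.consEquiv, Equiv.coe_fn_mk, List.ofFn_succ, Fin.cons_zero,
      Fin.cons_succ, wt, Fintype.sum_bool, Finset.mul_sum]
    cases a
    · simp [mul_assoc, add_comm]
    · simp [mul_assoc]

lemma sum_markov (q : ℝ) {n : ℕ} (hn : 0 < n) (f : List Bool → ℝ) :
    ∑ x : Fin n → Bool, markovP q x * f (List.ofFn x) = Et q n f := by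
  unfold Et
  rw [EE_eq_sum, EE_eq_sum, ← Finset.sum_add_distrib, Finset.sum_div]
  refine Finset.sum_congr rfl fun x _ => ?_
  rw [markovP_eq q hn]; ring

lemma lcs_bdd (x y : List Bool) :
    BddAbove {m : ℕ | ∃ z : List Bool, z.Sublist x ∧ z.Sublist y ∧ z.length = m} :=
  ⟨x.length, by rintro m ⟨z, h, _, rfl⟩; exact h.length_le⟩

lemma le_lcs {x y z : List Bool} (h1 : z.Sublist x) (h2 : z.Sublist y) : z.length ≤ lcsLen x y :=
  le_csSup (lcs_bdd x y) ⟨z, h1, h2, rfl⟩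

lemma lcs_exists (x y : List Bool) :
    ∃ z : List Bool, z.Sublist x ∧ z.Sublist y ∧ z.length = lcsLen x y :=
  Nat.sSup_mem (s := {m : ℕ | ∃ z : List Bool, z.Sublist x ∧ z.Sublist y ∧ z.length = m})
    ⟨0, [], by simp⟩ (lcs_bdd x y)

lemma lcs_comm (x y : List Bool) : lcsLen x y = lcsLen y x := by
  unfold lcsLen
  congr 1
  ext m
  constructor <;> rintro ⟨z, h1, h2, h3⟩ <;> exact ⟨z, h2, h1, h3⟩

lemma lcs_lip (y : List Bool) : Lip (fun x => (lcsLen x y : ℝ)) := by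
  intro u a b v
  obtain ⟨z, h1, h2, h3⟩ := lcs_exists (u ++ a :: v) y
  have : lcsLen (u ++ a :: v) y ≤ lcsLen (u ++ b :: v) y + 1 := by
    rw [← h3]
    obtain ⟨z1, z2, rfl, hz1, hz2⟩ := List.sublist_append_iff.1 h1
    rcases List.sublist_cons_iff.1 hz2 with h | ⟨r, rfl, h⟩
    · exact (le_lcs (hz1.append (h.cons b)) h2).trans (Nat.le_succ _)
    · have := le_lcs (hz1.append (h.cons b)) (((List.Sublist.refl z1).append
        (List.sublist_cons_self a r)).trans h2)
      simp only [List.length_append, List.length_cons] at this ⊢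
      omega
  beta_reduce
  exact_mod_cast this

lemma exp_eq (q : ℝ) {n : ℕ} (hn : 0 < n) :
    expLCSMarkov q n = Et q n (fun y => Et q n (fun x => (lcsLen x y : ℝ))) := by
  rw [← sum_markov q hn, expLCSMarkov, Finset.sum_comm]
  refine Finset.sum_congr rfl fun y _ => ?_
  rw [← sum_markov q hn, Finset.mul_sum]
  refine Finset.sum_congr rfl fun x _ => ?_
  ring

lemma mgf_lcs {q r K t : ℝ} (h0 : 0 ≤ q) (h1 : q ≤ 1) (hr : r = |2 * q - 1|) (hK : 1 + r * K = K)
    (hK0 : 0 ≤ K) (ht : 0 ≤ t) (htK : t * K ≤ 1) {n : ℕ} (hn : 0 < n) :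
    Et q n (fun y => Et q n (fun x => Real.exp (t * lcsLen x y))) ≤
      Real.exp (t * expLCSMarkov q n + 2 * (n + 1) * (K ^ 2 * t ^ 2)) := by
  have s1 := Et_mono h0 h1 n _ _ (fun y => Et_mgf h0 h1 hr hK hK0 ht htK n _ (lcs_lip y))
  have hl : Lip (fun y => Et q n (fun x => (lcsLen x y : ℝ))) := by
    intro u a b v
    have := Et_mono h0 h1 n (fun x => (lcsLen x (u ++ a :: v) : ℝ))
      (fun x => (lcsLen x (u ++ b :: v) : ℝ) + 1) (fun x => by
        rw [lcs_comm x, lcs_comm x]; exact lcs_lip x u a b v)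
    rwa [Et_add n (fun x => (lcsLen x (u ++ b :: v) : ℝ))] at this
  have s2 := Et_mgf h0 h1 hr hK hK0 ht htK n _ hl
  rw [exp_eq q hn]
  refine s1.trans ?_
  simp only [Real.exp_add _ ((n + 1) * (K ^ 2 * t ^ 2))]
  have e : Et q n (fun y => Real.exp (t * Et q n (fun x => (lcsLen x y : ℝ))) *
      Real.exp ((n + 1) * (K ^ 2 * t ^ 2))) = Real.exp ((n + 1) * (K ^ 2 * t ^ 2)) *
      Et q n (fun y => Real.exp (t * Et q n (fun x => (lcsLen x y : ℝ)))) := by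
    rw [← Et_mul]; congr 1; ext y; ring
  rw [e]
  calc _ ≤ _ := mul_le_mul_of_nonneg_left s2 (Real.exp_nonneg _)
    _ = _ := by rw [← Real.exp_add]; ring_nf

lemma markovP_nonneg {q : ℝ} (h0 : 0 ≤ q) (h1 : q ≤ 1) {n : ℕ} (x : Fin n → Bool) :
    0 ≤ markovP q x := by
  have : 0 ≤ 1 - q := by linarith
  unfold markovP; positivity

lemma markovP_sum (q : ℝ) {n : ℕ} (hn : 0 < n) : ∑ x : Fin n → Bool, markovP q x = 1 := by
  have h := sum_markov q hn (fun _ => 0 * (0:ℝ) + 1)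
  rw [Et_add n (fun _ => 0 * (0:ℝ)) 1, Et_mul n (fun _ => (0:ℝ)) 0] at h
  simpa using h

open Classical in
lemma code_exists {α : Type*} [Fintype α] (w : α → ℝ) (hw : ∀ x, 0 ≤ w x) (hw1 : ∑ x, w x = 1)
    (bad : α → α → Prop) (hsymm : ∀ x y, bad x y → bad y x) (hrefl : ∀ x, bad x x)
    (β : ℝ) (hβ : 0 < β)
    (hbad : ∑ x, ∑ y, w x * w y * (if bad x y then 1 else 0) ≤ β ^ 2) :
    ∃ C : Finset α, 1 - β ≤ C.card * β ∧ ∀ x ∈ C, ∀ y ∈ C, x ≠ y → ¬ bad x y := by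
  set P : α → ℝ := fun x => ∑ y, w y * (if bad x y then 1 else 0) with hP
  have hP0 : ∀ x, 0 ≤ P x := fun x => Finset.sum_nonneg fun y _ => by
    have := hw y; split_ifs <;> simp [this]
  have hbad' : ∑ x, w x * P x ≤ β ^ 2 := by
    refine le_trans (le_of_eq ?_) hbad
    refine Finset.sum_congr rfl fun x _ => ?_
    rw [hP, Finset.mul_sum]
    exact Finset.sum_congr rfl fun y _ => by ring
  set G : Finset α := Finset.univ.filter (fun x => P x ≤ β) with hG
  have hGs : 1 - β ≤ ∑ x ∈ G, w x := by
    have hsplit := Finset.sum_filter_add_sum_filter_not Finset.univ (fun x => P x ≤ β) w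
    rw [hw1] at hsplit
    have : β * ∑ x ∈ Finset.univ.filter (fun x => ¬ P x ≤ β), w x ≤ β * β := by
      rw [Finset.mul_sum]
      calc _ ≤ ∑ x ∈ Finset.univ.filter (fun x => ¬ P x ≤ β), w x * P x := by
            refine Finset.sum_le_sum fun x hx => ?_
            have := (Finset.mem_filter.1 hx).2
            rw [mul_comm]
            exact mul_le_mul_of_nonneg_left (not_le.1 this).le (hw x)
        _ ≤ ∑ x, w x * P x := Finset.sum_le_sum_of_subset_of_nonneg (Finset.filter_subset _ _)
            (fun x _ _ => mul_nonneg (hw x) (hP0 x))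
        _ ≤ _ := by rw [← sq]; exact hbad'
    have := le_of_mul_le_mul_left this hβ
    linarith
  let S : Finset (Finset α) := Finset.univ.filter
    (fun C => C ⊆ G ∧ ∀ x ∈ C, ∀ y ∈ C, x ≠ y → ¬ bad x y)
  have hS : S.Nonempty := ⟨∅, by simp [S]⟩
  obtain ⟨C, hCS, hmax⟩ := Finset.exists_max_image S Finset.card hS
  obtain ⟨hCG, hC⟩ := (Finset.mem_filter.1 hCS).2
  refine ⟨C, ?_, hC⟩
  have hcov : ∀ x ∈ G, ∃ c ∈ C, bad c x := by
    intro x hx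
    by_contra hno
    push Not at hno
    have hxC : x ∉ C := fun h => hno x h (hrefl x)
    have hmem : insert x C ∈ S := by
      refine Finset.mem_filter.2 ⟨Finset.mem_univ _, Finset.insert_subset hx hCG, ?_⟩
      intro a ha b hb hab
      rcases Finset.mem_insert.1 ha with ha | ha <;> rcases Finset.mem_insert.1 hb with hb | hb
      · exact absurd (ha.trans hb.symm) hab
      · rw [ha]; exact fun h => hno b hb (hsymm _ _ h)
      · rw [hb]; exact hno a ha
      · exact hC a ha b hb hab
    have := hmax _ hmem
    rw [Finset.card_insert_of_notMem hxC] at this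
    omega
  calc 1 - β ≤ ∑ x ∈ G, w x := hGs
    _ ≤ ∑ x ∈ G, ∑ c ∈ C, w x * (if bad c x then 1 else 0) := by
      refine Finset.sum_le_sum fun x hx => ?_
      obtain ⟨c, hc, hb⟩ := hcov x hx
      calc w x = w x * (if bad c x then 1 else 0) := by simp [hb]
        _ ≤ _ := Finset.single_le_sum (f := fun c => w x * (if bad c x then (1:ℝ) else 0))
          (fun i _ => mul_nonneg (hw x) (by split_ifs <;> simp)) hc
    _ ≤ ∑ x, ∑ c ∈ C, w x * (if bad c x then 1 else 0) :=
      Finset.sum_le_sum_of_subset_of_nonneg (Finset.subset_univ _) (fun x _ _ =>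
        Finset.sum_nonneg fun i _ => mul_nonneg (hw x) (by split_ifs <;> simp))
    _ = ∑ c ∈ C, P c := Finset.sum_comm
    _ ≤ ∑ c ∈ C, β := Finset.sum_le_sum fun c hc => (Finset.mem_filter.1 (hCG hc)).2
    _ = C.card * β := by simp

open Classical in
lemma tail_bound {q r K t : ℝ} (h0 : 0 ≤ q) (h1 : q ≤ 1) (hr : r = |2 * q - 1|)
    (hK : 1 + r * K = K)
    (hK0 : 0 ≤ K) (ht : 0 ≤ t) (htK : t * K ≤ 1) {n : ℕ} (hn : 0 < n) (s : ℝ) :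
    ∑ x : Fin n → Bool, ∑ y : Fin n → Bool, markovP q x * markovP q y *
      (if s ≤ (lcsLen (List.ofFn x) (List.ofFn y) : ℝ) then 1 else 0) ≤
      Real.exp (t * expLCSMarkov q n + 2 * (n + 1) * (K ^ 2 * t ^ 2) - t * s) := by
  have h := mgf_lcs h0 h1 hr hK hK0 ht htK hn
  rw [Real.exp_sub, le_div_iff₀ (Real.exp_pos _)]
  refine le_trans ?_ h
  rw [← sum_markov q hn, Finset.sum_comm, Finset.sum_mul]
  refine Finset.sum_le_sum fun y _ => ?_
  rw [← sum_markov q hn, Finset.mul_sum, Finset.sum_mul]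
  refine Finset.sum_le_sum fun x _ => ?_
  have p1 := markovP_nonneg h0 h1 x
  have p2 := markovP_nonneg h0 h1 y
  rw [← mul_assoc, mul_comm (markovP q y), mul_assoc]
  refine mul_le_mul_of_nonneg_left ?_ (mul_nonneg p1 p2)
  split_ifs with hs
  · rw [one_mul]
    exact Real.exp_le_exp.2 (mul_le_mul_of_nonneg_left hs ht)
  · rw [zero_mul]; positivity

/-- Fix q ∈ (0,1) and let γ_q ∈ [0,1] be the limit of L^q_n/n. Then
for every p with 0 < p < 1 - γ_q there are c > 0 and N such that for all n ≥ N
there is a set C of binary strings of length n with |C| ≥ 2^{c·n} in which any two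
distinct strings have LCS of length strictly less than (1-p)·n. -/
theorem stmt_15 (q : ℝ) (hq : q ∈ Set.Ioo (0 : ℝ) 1)
    (γq : ℝ) (hγq : γq ∈ Set.Icc (0 : ℝ) 1)
    (hlim : Filter.Tendsto (fun n : ℕ => expLCSMarkov q n / n) Filter.atTop (nhds γq))
    (p : ℝ) (hp0 : 0 < p) (hp1 : p < 1 - γq) :
    ∃ c : ℝ, 0 < c ∧ ∃ N : ℕ, ∀ n : ℕ, N ≤ n →
      ∃ C : Finset (Fin n → Bool),
        (2 : ℝ) ^ (c * n) ≤ (C.card : ℝ) ∧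
        ∀ x ∈ C, ∀ y ∈ C, x ≠ y →
          (lcsLen (List.ofFn x) (List.ofFn y) : ℝ) < (1 - p) * n := by
  classical
  obtain ⟨hq0, hq1⟩ := hq
  set r : ℝ := |2 * q - 1| with hr
  have hr1 : r < 1 := by rw [hr, abs_lt]; constructor <;> linarith
  have hr0 : 0 ≤ r := abs_nonneg _
  set K : ℝ := 1 / (1 - r) with hKdef
  have hrp : 0 < 1 - r := by linarith
  have hK0 : 0 < K := by positivity
  have hK : 1 + r * K = K := by rw [hKdef]; field_simp; ring
  set ε : ℝ := (1 - p - γq) / 2 with hε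
  have hε0 : 0 < ε := by rw [hε]; linarith
  set t : ℝ := min (1 / K) (ε / (8 * K ^ 2)) with htdef
  have ht0 : 0 < t := by rw [htdef]; positivity
  have htK : t * K ≤ 1 := by
    rw [← le_div_iff₀ hK0]; exact min_le_left _ _
  have htε : 8 * (K ^ 2 * t) ≤ ε := by
    have : t ≤ ε / (8 * K ^ 2) := min_le_right _ _
    rw [le_div_iff₀ (by positivity)] at this
    linarith
  set δ : ℝ := t * ε / 2 with hδ
  have hδ0 : 0 < δ := by positivity
  have hlog : 0 < Real.log 2 := Real.log_pos (by norm_num)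
  have hev := hlim.eventually (gt_mem_nhds (show γq < γq + ε by linarith))
  obtain ⟨N0, hN0⟩ := Filter.eventually_atTop.1 hev
  refine ⟨δ / (4 * Real.log 2), by positivity, max (max N0 1) ⌈4 * Real.log 2 / δ⌉₊, ?_⟩
  intro n hn
  have hn0 : N0 ≤ n := (le_max_left _ _).trans ((le_max_left _ _).trans hn)
  have hn1 : 1 ≤ n := (le_max_right _ _).trans ((le_max_left _ _).trans hn)
  have hn2 : 4 * Real.log 2 / δ ≤ n := (Nat.le_ceil _).trans (by exact_mod_cast (le_max_right _ _).trans hn)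
  have hn1r : (1 : ℝ) ≤ n := by exact_mod_cast hn1
  have hnp : (0 : ℝ) < n := by linarith
  rw [div_le_iff₀ hδ0] at hn2
  have hEL : expLCSMarkov q n ≤ (γq + ε) * n := by
    have := hN0 n hn0
    rw [div_lt_iff₀ hnp] at this
    exact this.le
  have htail := tail_bound hq0.le hq1.le hr hK hK0.le ht0.le htK (n := n) (by omega) ((1 - p) * n)
  have hexp : t * expLCSMarkov q n + 2 * (n + 1) * (K ^ 2 * t ^ 2) - t * ((1 - p) * n) ≤ -(δ * n) := by
    have e1 : t * expLCSMarkov q n ≤ t * ((γq + ε) * n) := by gcongr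
    have e2 : 2 * ((n : ℝ) + 1) * (K ^ 2 * t ^ 2) ≤ 2 * (n + n) * (K ^ 2 * t ^ 2) := by gcongr
    have e3 : (n * t / 2) * (8 * (K ^ 2 * t)) ≤ (n * t / 2) * ε := by gcongr
    have e4 : (1 - p) = γq + 2 * ε := by rw [hε]; ring
    rw [e4, hδ]
    nlinarith
  set β : ℝ := Real.exp (-(δ * n) / 2) with hβ
  have hβ0 : 0 < β := Real.exp_pos _
  have hβ2 : β ^ 2 = Real.exp (-(δ * n)) := by
    rw [hβ, ← Real.exp_nat_mul]; congr 1; push_cast; ring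
  obtain ⟨C, hcard, hC⟩ := code_exists (α := Fin n → Bool) (markovP q)
    (markovP_nonneg hq0.le hq1.le) (markovP_sum q (by omega))
    (fun x y => (1 - p) * n ≤ (lcsLen (List.ofFn x) (List.ofFn y) : ℝ))
    (fun x y h => by rw [lcs_comm]; exact h)
    (fun x => by
      have := le_lcs (List.Sublist.refl (List.ofFn x)) (List.Sublist.refl (List.ofFn x))
      rw [List.length_ofFn] at this
      have : (n : ℝ) ≤ lcsLen (List.ofFn x) (List.ofFn x) := by exact_mod_cast this
      nlinarith)
    β hβ0 (by
      rw [hβ2]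
      exact htail.trans (Real.exp_le_exp.2 hexp))
  refine ⟨C, ?_, fun x hx y hy hxy => not_le.1 (hC x hx y hy hxy)⟩
  set A : ℝ := Real.exp (δ * n / 4) with hA
  have hA0 : 0 < A := Real.exp_pos _
  have hA2 : 2 ≤ A := by
    rw [hA, ← Real.log_le_iff_le_exp (by norm_num)]; linarith
  have hAβ : A * A * β = 1 := by
    rw [hA, hβ, ← Real.exp_add, ← Real.exp_add, ← Real.exp_zero]; congr 1; ring
  have hpow : (2 : ℝ) ^ (δ / (4 * Real.log 2) * n) = A := by
    rw [Real.rpow_def_of_pos (by norm_num), hA]; congr 1; field_simp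
  rw [hpow]
  have h5 : A * A * (1 - β) ≤ C.card := by
    calc A * A * (1 - β) ≤ A * A * (C.card * β) := by gcongr
      _ = C.card * (A * A * β) := by ring
      _ = C.card := by rw [hAβ, mul_one]
  nlinarith
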